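/- Sub-Gaussian property: for every N ∈ ℕ, every λ ∈ ℝ and every real vector (a_0, …, a_{N−1}) ∈ ℝ^N, one has 𝔼[exp(λ ∑_{n=0}^{N−1} (ξ_n − σ) a_n)] ≤ exp(λ² ∑_{n=0}^{N−1} a_n²). -/

import Mathlib

open MeasureTheory Complex Filter Finset
open scoped ENNReal

noncomputable def fhat (f : AddCircle (1:ℝ) → ℝ) (k : ℤ) : ℂ :=
  fourierCoeff (fun t => (f t : ℂ)) k

section Aux
open scoped ComplexOrder

open ComplexConjugate in
lemma aux_psd {ι : Type*} [Fintype ι] (g : AddCircle (1:ℝ) → ℝ) (hg : Measurable g)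
    (hg01 : ∀ t, g t ∈ Set.Icc (0:ℝ) 1) (n : ι → ℤ) :
    (Matrix.of fun i j => fhat g (n i - n j) : Matrix ι ι ℂ).PosSemidef := by
  have hint : Integrable (fun t => (g t : ℂ)) (AddCircle.haarAddCircle (T := (1:ℝ))) := by
    refine Integrable.of_bound (C := 1) (by fun_prop) (ae_of_all _ fun t => ?_)
    have := hg01 t
    simp only [Complex.norm_real, Real.norm_eq_abs]
    rw [abs_of_nonneg this.1]; exact this.2
  have hintk : ∀ k : ℤ, Integrable (fun t => fourier k t * (g t : ℂ))
      (AddCircle.haarAddCircle (T := (1:ℝ))) := fun k => hint.fourier_smul k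
  refine Matrix.PosSemidef.of_dotProduct_mulVec_nonneg ?_ ?_
  · ext i j
    simp only [Matrix.conjTranspose_apply, Matrix.of_apply, fhat, fourierCoeff, smul_eq_mul,
      RCLike.star_def]
    rw [← integral_conj]
    congr 1
    ext t
    rw [map_mul, Complex.conj_ofReal, ← fourier_neg]
    congr 2
    ring
  · intro x
    have key : star x ⬝ᵥ (Matrix.of fun i j => fhat g (n i - n j) : Matrix ι ι ℂ).mulVec x
        = ((∫ t, g t * Complex.normSq (∑ j, x j * fourier (n j) t)
            ∂(AddCircle.haarAddCircle (T := (1:ℝ))) : ℝ) : ℂ) := by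
      rw [← integral_complex_ofReal]
      have : ∀ t : AddCircle (1:ℝ), ((g t * Complex.normSq (∑ j, x j * fourier (n j) t) : ℝ) : ℂ)
          = ∑ i, ∑ j, (conj (x i) * x j) * (fourier (-(n i - n j)) t * (g t : ℂ)) := by
        intro t
        push_cast
        rw [Complex.normSq_eq_conj_mul_self, map_sum, Finset.sum_mul_sum, Finset.mul_sum]
        refine Finset.sum_congr rfl fun i _ => ?_
        rw [Finset.mul_sum]
        refine Finset.sum_congr rfl fun j _ => ?_
        rw [map_mul, ← fourier_neg, show -(n i - n j) = -n i + n j by ring, fourier_add]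
        ring
      simp_rw [this]
      rw [integral_finsetSum _ fun i _ => integrable_finsetSum _ fun j _ => (hintk _).const_mul _]
      simp only [dotProduct, Matrix.mulVec, Matrix.of_apply, Pi.star_apply, RCLike.star_def]
      refine Finset.sum_congr rfl fun i _ => ?_
      rw [integral_finsetSum _ fun j _ => (hintk _).const_mul _, Finset.mul_sum]
      refine Finset.sum_congr rfl fun j _ => ?_
      rw [integral_const_mul]
      simp only [fhat, fourierCoeff, smul_eq_mul]
      ring
    rw [key]
    exact_mod_cast integral_nonneg fun t => mul_nonneg (hg01 t).1 (Complex.normSq_nonneg _)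

lemma aux_one_sub (f : AddCircle (1:ℝ) → ℝ) (hf : Measurable f)
    (hf01 : ∀ t, f t ∈ Set.Icc (0:ℝ) 1) (k : ℤ) :
    fhat (fun t => 1 - f t) k = (if k = 0 then 1 else 0) - fhat f k := by
  have hint : Integrable (fun t => (f t : ℂ)) (AddCircle.haarAddCircle (T := (1:ℝ))) := by
    refine Integrable.of_bound (C := 1) (by fun_prop) (ae_of_all _ fun t => ?_)
    have := hf01 t
    simp only [Complex.norm_real, Real.norm_eq_abs]
    rw [abs_of_nonneg this.1]; exact this.2
  have h1 : Integrable (fun t => fourier (-k) t * (f t : ℂ))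
      (AddCircle.haarAddCircle (T := (1:ℝ))) := hint.fourier_smul (-k)
  have h2 : Integrable (fun t => fourier (-k) t)
      (AddCircle.haarAddCircle (T := (1:ℝ))) := by
    simpa [-fourier_apply] using
      (integrable_const (μ := AddCircle.haarAddCircle (T := (1:ℝ))) (1:ℂ)).fourier_smul (-k)
  have h3 : ∫ t, fourier (-k) t ∂(AddCircle.haarAddCircle (T := (1:ℝ)))
      = if k = 0 then 1 else 0 := by
    split_ifs with h
    · subst h; simp
    · exact integral_eq_zero_of_add_right_eq_neg (fourier_add_half_inv_index (by simpa using h) (by norm_num))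
  simp only [fhat, fourierCoeff, smul_eq_mul]
  push_cast
  simp_rw [mul_sub, mul_one]
  rw [integral_sub h2 h1, h3]

lemma aux_hadamard {ι : Type*} [Fintype ι] [DecidableEq ι] (A : Matrix ι ι ℂ) (hA : A.PosSemidef)
    (d : ι → ℝ) (hd : ∀ i, 0 < d i) (hAd : ∀ i, A i i = d i) :
    A.det.re ≤ ∏ i, d i := by
  set S : Matrix ι ι ℂ := Matrix.diagonal (fun i => (((√(d i))⁻¹ : ℝ) : ℂ)) with hS
  set B := S.conjTranspose * A * S with hBdef
  have hB : B.PosSemidef := hA.conjTranspose_mul_mul_same S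
  have hSc : S.conjTranspose = S := by
    rw [hS, Matrix.diagonal_conjTranspose]; congr 1; ext i; simp
  have hsq : ∀ i, (√(d i))⁻¹ * (√(d i))⁻¹ = (d i)⁻¹ := fun i => by
    rw [← mul_inv, Real.mul_self_sqrt (hd i).le]
  have hdiag : ∀ i, B i i = 1 := by
    intro i
    rw [hBdef, hSc, hS, Matrix.mul_diagonal, Matrix.diagonal_mul, hAd]
    norm_cast
    rw [mul_right_comm, hsq, inv_mul_cancel₀ (hd i).ne']
  have htr : ∑ i, hB.1.eigenvalues i = Fintype.card ι := by
    have h := hB.1.trace_eq_sum_eigenvalues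
    simp only [Matrix.trace, Matrix.diag, hdiag] at h
    have h2 := congrArg Complex.re h
    simpa using h2.symm
  have hdet : B.det = A.det * (((∏ i, d i)⁻¹ : ℝ) : ℂ) := by
    rw [hBdef, hSc, hS, Matrix.det_mul, Matrix.det_mul, Matrix.det_diagonal]
    rw [mul_comm _ A.det, mul_assoc, ← Finset.prod_mul_distrib, ← Finset.prod_inv_distrib]
    push_cast
    congr 1
    refine Finset.prod_congr rfl fun i _ => ?_
    exact_mod_cast hsq i
  have hBle : B.det.re ≤ 1 := by
    rw [hB.1.det_eq_prod_eigenvalues]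
    calc _ = ∏ i, hB.1.eigenvalues i := by
          exact_mod_cast Complex.ofReal_re _
      _ ≤ ∏ i, Real.exp (hB.1.eigenvalues i - 1) :=
          Finset.prod_le_prod (fun i _ => hB.eigenvalues_nonneg i)
            fun i _ => by linarith [Real.add_one_le_exp (hB.1.eigenvalues i - 1)]
      _ = 1 := by
          rw [← Real.exp_sum, Finset.sum_sub_distrib, htr]; simp
  rw [hdet, Complex.re_mul_ofReal, ← div_eq_mul_inv, div_le_one (Finset.prod_pos fun i _ => hd i)]
    at hBle
  exact hBle

lemma aux_expand {ι : Type*} [Fintype ι] [DecidableEq ι] (K : Matrix ι ι ℂ) (c : ι → ℂ) :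
    (1 + Matrix.diagonal c * K).det = ∑ s : Finset ι, (∏ i ∈ s, c i) *
      (K.submatrix (Subtype.val : s → ι) (Subtype.val : s → ι)).det := by
  have h := (Matrix.detRowAlternating (n := ι) (R := ℂ)).toMultilinearMap.map_add_univ
    (fun i => (Matrix.diagonal c * K) i) (fun i => (1 : Matrix ι ι ℂ) i)
  rw [add_comm]
  refine Eq.trans h ?_
  refine Finset.sum_congr rfl fun s _ => ?_
  refine Eq.trans (Matrix.det_piecewise_one_eq_submatrix_det (Matrix.diagonal c * K) s) ?_
  have : (Matrix.diagonal c * K).submatrix (Subtype.val : s → ι) (Subtype.val : s → ι)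
      = Matrix.diagonal (fun i : s => c i) * 
        K.submatrix (Subtype.val : s → ι) (Subtype.val : s → ι) := by
    ext i j
    simp [Matrix.diagonal_mul]
  rw [this, Matrix.det_mul, Matrix.det_diagonal]
  congr 1
  exact Finset.prod_coe_sort s c

lemma aux_det_pos {ι : Type*} [Fintype ι] [DecidableEq ι] (K : Matrix ι ι ℂ) (hK : K.PosSemidef)
    (σ : ℝ) (hσ0 : 0 < σ) (hd : ∀ i, K i i = σ) (c : ι → ℝ) (hc : ∀ i, 0 ≤ c i) :
    (1 + Matrix.diagonal (fun i => (c i : ℂ)) * K).det.re ≤ ∏ i, (1 + c i * σ) := by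
  set S : Matrix ι ι ℂ := Matrix.diagonal (fun i => ((√(c i) : ℝ) : ℂ)) with hS
  have hSc : S.conjTranspose = S := by
    rw [hS, Matrix.diagonal_conjTranspose]; congr 1; ext i; simp
  have hSS : Matrix.diagonal (fun i => (c i : ℂ)) = S * S := by
    rw [hS, Matrix.diagonal_mul_diagonal]; congr 1; ext i
    exact_mod_cast (Real.mul_self_sqrt (hc i)).symm
  rw [hSS, mul_assoc, Matrix.det_one_add_mul_comm]
  apply aux_hadamard
  · refine Matrix.PosSemidef.one.add ?_
    have := hK.conjTranspose_mul_mul_same S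
    rwa [hSc] at this
  · intro i; have := mul_nonneg (hc i) hσ0.le; linarith
  · intro i
    rw [Matrix.add_apply, hS, Matrix.mul_diagonal, Matrix.diagonal_mul, hd, Matrix.one_apply_eq,
      mul_right_comm]
    norm_cast
    rw [Real.mul_self_sqrt (hc i)]

lemma aux_det_neg {ι : Type*} [Fintype ι] [DecidableEq ι] (K : Matrix ι ι ℂ)
    (hK : (1 - K).PosSemidef)
    (σ : ℝ) (hσ0 : 0 < σ) (hσ1 : σ < 1) (hd : ∀ i, K i i = σ) (c : ι → ℝ) (hc : ∀ i, c i ≤ 0)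
    (hc1 : ∀ i, -1 ≤ c i) :
    (1 + Matrix.diagonal (fun i => (c i : ℂ)) * K).det.re ≤ ∏ i, (1 + c i * σ) := by
  set S : Matrix ι ι ℂ := Matrix.diagonal (fun i => ((√(-c i) : ℝ) : ℂ)) with hS
  have hSc : S.conjTranspose = S := by
    rw [hS, Matrix.diagonal_conjTranspose]; congr 1; ext i; simp
  have hsq : ∀ i, √(-c i) * √(-c i) = - c i := fun i => Real.mul_self_sqrt (by linarith [hc i])
  have hSS : Matrix.diagonal (fun i => (c i : ℂ)) = S * (-S) := by
    rw [hS, mul_neg, Matrix.diagonal_mul_diagonal, Matrix.diagonal_neg]; congr 1; ext i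
    have := hsq i
    rw [eq_comm, neg_eq_iff_eq_neg]
    exact_mod_cast this
  rw [hSS, mul_assoc, Matrix.det_one_add_mul_comm]
  apply aux_hadamard
  · have h1 := hK.conjTranspose_mul_mul_same S
    rw [hSc] at h1
    have h2 : (1 - S * S).PosSemidef := by
      rw [hS, Matrix.diagonal_mul_diagonal, ← Matrix.diagonal_one, Matrix.diagonal_sub]
      refine Matrix.PosSemidef.diagonal fun i => ?_
      have : (0:ℝ) ≤ 1 - √(-c i) * √(-c i) := by rw [hsq]; linarith [hc1 i]
      simpa using (by exact_mod_cast this : (0:ℂ) ≤ ((1 - √(-c i) * √(-c i) : ℝ) : ℂ))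
    convert h2.add h1 using 1
    noncomm_ring
  · intro i; nlinarith [hc1 i, hc i]
  · intro i
    rw [neg_mul, neg_mul, Matrix.add_apply, Matrix.neg_apply, hS, Matrix.mul_diagonal,
      Matrix.diagonal_mul, hd, Matrix.one_apply_eq, mul_right_comm]
    norm_cast
    rw [hsq]; ring_nf

section Prob
variable {Ω : Type*} [MeasurableSpace Ω] (P : Measure Ω) [IsProbabilityMeasure P]

lemma aux_fhat_zero (f : AddCircle (1:ℝ) → ℝ) :
    fhat f 0 = ((∫ t, f t ∂AddCircle.haarAddCircle : ℝ) : ℂ) := by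
  simp only [fhat, fourierCoeff, neg_zero, fourier_zero, one_smul]
  exact integral_complex_ofReal

lemma aux_exp01 (x b : ℝ) (hx : x = 0 ∨ x = 1) :
    Real.exp (b * x) = 1 + (Real.exp b - 1) * x := by
  rcases hx with rfl | rfl <;> simp

lemma aux_hoeffding (X : Ω → ℝ) (hX : Measurable X) (hX01 : ∀ ω, X ω = 0 ∨ X ω = 1)
    (σ : ℝ) (hσ : ∫ ω, X ω ∂P = σ) (b : ℝ) :
    1 + (Real.exp b - 1) * σ ≤ Real.exp (b * σ + b ^ 2 / 8) := by
  have hmem : ∀ ω, X ω ∈ Set.Icc (0:ℝ) 1 := fun ω => by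
    rcases hX01 ω with h | h <;> simp [h]
  have hint : Integrable X P := Integrable.of_mem_Icc 0 1 hX.aemeasurable (ae_of_all _ hmem)
  have h := (ProbabilityTheory.hasSubgaussianMGF_of_mem_Icc (μ := P) hX.aemeasurable
    (ae_of_all _ hmem)).mgf_le b
  rw [ProbabilityTheory.mgf, hσ] at h
  have h2 : ∀ ω, Real.exp (b * (X ω - σ))
      = Real.exp (-(b * σ)) * (1 + (Real.exp b - 1) * X ω) := fun ω => by
    rw [← aux_exp01 _ _ (hX01 ω), ← Real.exp_add]; ring_nf
  simp_rw [h2] at h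
  rw [integral_const_mul, integral_add (integrable_const _) (hint.const_mul _),
    integral_const_mul, hσ, Real.exp_neg, inv_mul_le_iff₀ (Real.exp_pos _), ← Real.exp_add] at h
  simp only [integral_const, probReal_univ, smul_eq_mul, mul_one] at h
  refine h.trans (Real.exp_le_exp.mpr (le_of_eq ?_))
  simp
  ring

lemma aux_int_prod (ξ : ℤ → Ω → ℝ) (hξ_meas : ∀ n, Measurable (ξ n))
    (hξ01 : ∀ n ω, ξ n ω = 0 ∨ ξ n ω = 1)
    (s : Finset ℤ) : Integrable (fun ω => ∏ i ∈ s, ξ i ω) P := by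
  refine Integrable.of_mem_Icc 0 1
    (Finset.measurable_fun_prod s fun i _ => hξ_meas i).aemeasurable (ae_of_all _ fun ω => ?_)
  have h0 : ∀ i, 0 ≤ ξ i ω := fun i => by rcases hξ01 i ω with h | h <;> simp [h]
  have h1 : ∀ i, ξ i ω ≤ 1 := fun i => by rcases hξ01 i ω with h | h <;> simp [h]
  exact ⟨Finset.prod_nonneg fun i _ => h0 i, Finset.prod_le_one (fun i _ => h0 i) fun i _ => h1 i⟩

lemma aux_dpp (f : AddCircle (1:ℝ) → ℝ) (ξ : ℤ → Ω → ℝ)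
    (hDPP : ∀ (k : ℕ) (n : Fin k → ℤ), Function.Injective n →
      ((∫ ω, ∏ i, ξ (n i) ω ∂P : ℝ) : ℂ) =
        Matrix.det (Matrix.of fun i j => fhat f (n i - n j)))
    {N : ℕ} (s : Finset (Fin N)) :
    ((∫ ω, ∏ i ∈ s, ξ ((i : ℕ) : ℤ) ω ∂P : ℝ) : ℂ) =
      ((Matrix.of fun i j : Fin N => fhat f (((i : ℕ) : ℤ) - ((j : ℕ) : ℤ))).submatrix
        (Subtype.val : s → Fin N) (Subtype.val : s → Fin N)).det := by
  have hinj : Function.Injective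
      (fun j : Fin s.card => ((((s.equivFin.symm j : s) : Fin N) : ℕ) : ℤ)) := by
    intro i j hij
    have h1 : (((s.equivFin.symm i : s) : Fin N) : ℕ) = (((s.equivFin.symm j : s) : Fin N) : ℕ) := by
      exact Int.ofNat_inj.mp hij
    exact s.equivFin.symm.injective (Subtype.ext (Fin.ext h1))
  have h := hDPP s.card _ hinj
  rw [← Matrix.det_submatrix_equiv_self s.equivFin.symm]
  refine Eq.trans ?_ (h.trans ?_)
  · congr 2
    ext ω
    rw [Equiv.prod_comp s.equivFin.symm (fun i : s => ξ (((i : Fin N) : ℕ) : ℤ) ω)]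
    exact (Finset.prod_coe_sort s (fun i : Fin N => ξ ((i : ℕ) : ℤ) ω)).symm
  · rfl

lemma aux_mgf (f : AddCircle (1:ℝ) → ℝ) (hf_meas : Measurable f) (hf01 : ∀ t, f t ∈ Set.Icc (0:ℝ) 1)
    (σ : ℝ) (hσ : σ = ∫ t, f t ∂AddCircle.haarAddCircle) (hσ0 : 0 < σ) (hσ1 : σ < 1)
    (ξ : ℤ → Ω → ℝ) (hξ_meas : ∀ n, Measurable (ξ n))
    (hξ01 : ∀ n ω, ξ n ω = 0 ∨ ξ n ω = 1)
    (hDPP : ∀ (k : ℕ) (n : Fin k → ℤ), Function.Injective n →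
      ((∫ ω, ∏ i, ξ (n i) ω ∂P : ℝ) : ℂ) =
        Matrix.det (Matrix.of fun i j => fhat f (n i - n j)))
    {N : ℕ} (b : Fin N → ℝ) (hb : (∀ i, 0 ≤ b i) ∨ (∀ i, b i ≤ 0)) :
    ∫ ω, Real.exp (∑ i, b i * (ξ ((i : ℕ) : ℤ) ω - σ)) ∂P ≤ Real.exp (∑ i, b i ^ 2 / 8) := by
  set K : Matrix (Fin N) (Fin N) ℂ :=
    Matrix.of fun i j : Fin N => fhat f (((i : ℕ) : ℤ) - ((j : ℕ) : ℤ)) with hK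
  set c : Fin N → ℝ := fun i => Real.exp (b i) - 1 with hc
  have hKd : ∀ i, K i i = σ := fun i => by
    simp only [hK, Matrix.of_apply, sub_self]
    rw [aux_fhat_zero, hσ]
  have hmean : ∀ m : ℤ, ∫ ω, ξ m ω ∂P = σ := fun m => by
    have h := hDPP 1 (fun _ => m) (Function.injective_of_subsingleton _)
    simp only [Finset.univ_unique, Finset.prod_singleton, Matrix.det_unique, Matrix.of_apply,
      sub_self] at h
    rw [aux_fhat_zero, ← hσ] at h
    exact_mod_cast h
  have hint : ∀ s : Finset (Fin N), Integrable (fun ω => ∏ i ∈ s, ξ ((i : ℕ) : ℤ) ω) P := by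
    intro s
    have h := aux_int_prod P ξ hξ_meas hξ01
      (s.map ⟨fun i : Fin N => ((i : ℕ) : ℤ), fun i j hij => Fin.ext (Int.ofNat_inj.mp hij)⟩)
    simp only [Finset.prod_map] at h
    exact h
  have hexp : ∫ ω, ∏ i, (1 + c i * ξ ((i : ℕ) : ℤ) ω) ∂P
      = (1 + Matrix.diagonal (fun i => (c i : ℂ)) * K).det.re := by
    rw [← Complex.ofReal_re (∫ ω, _ ∂P)]
    congr 1
    rw [aux_expand]
    simp_rw [Finset.prod_one_add, Finset.prod_mul_distrib]
    rw [integral_finsetSum _ fun s _ => (hint s).const_mul _, Finset.powerset_univ]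
    push_cast
    refine Finset.sum_congr rfl fun s _ => ?_
    rw [integral_const_mul, ← aux_dpp P f ξ hDPP s]
    push_cast
    rfl
  have hdet : (1 + Matrix.diagonal (fun i => (c i : ℂ)) * K).det.re ≤ ∏ i, (1 + c i * σ) := by
    rcases hb with hb | hb
    · exact aux_det_pos K (aux_psd f hf_meas hf01 _) σ hσ0 hKd c
        fun i => by simpa [hc] using hb i
    · refine aux_det_neg K ?_ σ hσ0 hσ1 hKd c (fun i => by simpa [hc] using hb i)
        fun i => by simpa [hc] using (Real.exp_pos (b i)).le
      have h := aux_psd (fun t => 1 - f t) (by fun_prop)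
        (fun t => ⟨by linarith [(hf01 t).2], by linarith [(hf01 t).1]⟩)
        (fun i : Fin N => ((i : ℕ) : ℤ))
      convert h using 1
      ext i j
      simp only [hK, Matrix.sub_apply, Matrix.of_apply, Matrix.one_apply]
      rw [aux_one_sub f hf_meas hf01]
      congr 1
      simp only [sub_eq_zero, Nat.cast_inj, Fin.ext_iff]
  have hpt : ∀ ω, Real.exp (∑ i, b i * (ξ ((i : ℕ) : ℤ) ω - σ))
      = Real.exp (-∑ i, b i * σ) * ∏ i, (1 + c i * ξ ((i : ℕ) : ℤ) ω) := fun ω => by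
    simp_rw [hc, ← aux_exp01 _ _ (hξ01 _ ω)]
    rw [← Real.exp_sum, ← Real.exp_add]
    congr 1
    simp_rw [mul_sub]
    rw [Finset.sum_sub_distrib]
    ring
  simp_rw [hpt]
  rw [integral_const_mul, hexp, Real.exp_neg, inv_mul_le_iff₀ (Real.exp_pos _), ← Real.exp_add,
    ← Finset.sum_add_distrib]
  refine hdet.trans ?_
  rw [Real.exp_sum]
  refine Finset.prod_le_prod (fun i _ => ?_) fun i _ => ?_
  · have := Real.exp_pos (b i)
    simp only [hc]; nlinarith
  · exact aux_hoeffding P (ξ ((i : ℕ) : ℤ)) (hξ_meas _) (hξ01 _) σ (hmean _) (b i)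

end Prob
end Aux

/-- Sub-Gaussian property: 𝔼[exp(λ ∑ (ξ_n − σ) a_n)] ≤ exp(λ² ∑ a_n²). -/
theorem stmt_6
    (f : AddCircle (1:ℝ) → ℝ) (hf_meas : Measurable f)
    (hf01 : ∀ t, f t ∈ Set.Icc (0:ℝ) 1)
    (σ : ℝ) (hσ : σ = ∫ t, f t ∂AddCircle.haarAddCircle)
    (hσ0 : 0 < σ) (hσ1 : σ < 1)
    {Ω : Type*} [MeasurableSpace Ω] (P : Measure Ω) [IsProbabilityMeasure P]
    (ξ : ℤ → Ω → ℝ) (hξ_meas : ∀ n, Measurable (ξ n))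
    (hξ01 : ∀ n ω, ξ n ω = 0 ∨ ξ n ω = 1)
    (hDPP : ∀ (k : ℕ) (n : Fin k → ℤ), Function.Injective n →
      ((∫ ω, ∏ i, ξ (n i) ω ∂P : ℝ) : ℂ) =
        Matrix.det (Matrix.of fun i j => fhat f (n i - n j))) :
    ∀ (N : ℕ) (lam : ℝ) (a : ℕ → ℝ),
      (∫ ω, Real.exp (lam * ∑ n ∈ Finset.range N, (ξ (n:ℤ) ω - σ) * a n) ∂P) ≤
        Real.exp (lam^2 * ∑ n ∈ Finset.range N, (a n)^2) := by
  intro N lam a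
  set b : Fin N → ℝ := fun i => lam * a i with hbdef
  set p : Fin N → ℝ := fun i => 2 * max (b i) 0 with hp
  set q : Fin N → ℝ := fun i => 2 * min (b i) 0 with hq
  have h1 := aux_mgf P f hf_meas hf01 σ hσ hσ0 hσ1 ξ hξ_meas hξ01 hDPP p
    (Or.inl fun i => by simp [hp])
  have h2 := aux_mgf P f hf_meas hf01 σ hσ hσ0 hσ1 ξ hξ_meas hξ01 hDPP q
    (Or.inr fun i => by have := min_le_right (b i) 0; simp only [hq]; linarith)
  set u := ∑ i, p i ^ 2 / 8 with hu
  set v := ∑ i, q i ^ 2 / 8 with hv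
  have hint : ∀ d : Fin N → ℝ,
      Integrable (fun ω => Real.exp (∑ i, d i * (ξ ((i : ℕ) : ℤ) ω - σ))) P := by
    intro d
    refine Integrable.of_bound (C := Real.exp (∑ i, |d i|)) (by fun_prop)
      (ae_of_all _ fun ω => ?_)
    rw [Real.norm_eq_abs, Real.abs_exp, Real.exp_le_exp]
    refine Finset.sum_le_sum fun i _ => (le_abs_self _).trans ?_
    rw [abs_mul]
    refine mul_le_of_le_one_right (abs_nonneg _) ?_
    rw [abs_le]
    rcases hξ01 ((i : ℕ) : ℤ) ω with h | h <;> rw [h] <;> constructor <;> linarith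
  have hpq : ∀ i, p i + q i = 2 * b i := fun i => by
    simp only [hp, hq]; rw [← mul_add, max_add_min, add_zero]
  have hpq2 : ∀ i, p i ^ 2 + q i ^ 2 = 4 * b i ^ 2 := fun i => by
    simp only [hp, hq]
    rcases le_total (b i) 0 with h | h
    · rw [max_eq_right h, min_eq_left h]; ring
    · rw [max_eq_left h, min_eq_right h]; ring
  have huv : (u + v) / 2 = ∑ i, b i ^ 2 / 4 := by
    rw [hu, hv, ← Finset.sum_add_distrib, Finset.sum_div]
    refine Finset.sum_congr rfl fun i _ => ?_
    linarith [hpq2 i]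
  have hpt : ∀ ω, Real.exp (lam * ∑ n ∈ Finset.range N, (ξ (n:ℤ) ω - σ) * a n)
      ≤ Real.exp ((v - u) / 2) / 2 * Real.exp (∑ i, p i * (ξ ((i : ℕ) : ℤ) ω - σ))
        + Real.exp ((u - v) / 2) / 2 * Real.exp (∑ i, q i * (ξ ((i : ℕ) : ℤ) ω - σ)) := by
    intro ω
    set x := ∑ i, p i * (ξ ((i : ℕ) : ℤ) ω - σ) with hx
    set y := ∑ i, q i * (ξ ((i : ℕ) : ℤ) ω - σ) with hy
    have hxy : lam * ∑ n ∈ Finset.range N, (ξ (n:ℤ) ω - σ) * a n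
        = ((v - u) / 2 + x) / 2 + ((u - v) / 2 + y) / 2 := by
      have : x + y = 2 * (lam * ∑ n ∈ Finset.range N, (ξ (n:ℤ) ω - σ) * a n) := by
        rw [hx, hy, ← Finset.sum_add_distrib, Finset.sum_range, Finset.mul_sum, Finset.mul_sum]
        refine Finset.sum_congr rfl fun i _ => ?_
        rw [← add_mul, hpq, hbdef]
        ring
      linarith
    rw [hxy, div_mul_eq_mul_div, div_mul_eq_mul_div, ← Real.exp_add, ← Real.exp_add,
      Real.exp_add (((v - u) / 2 + x) / 2)]
    have e1 : Real.exp ((v - u) / 2 + x) = Real.exp (((v - u) / 2 + x) / 2) ^ 2 := by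
      rw [← Real.exp_nat_mul]; congr 1; push_cast; ring
    have e2 : Real.exp ((u - v) / 2 + y) = Real.exp (((u - v) / 2 + y) / 2) ^ 2 := by
      rw [← Real.exp_nat_mul]; congr 1; push_cast; ring
    rw [e1, e2]
    nlinarith [sq_nonneg (Real.exp (((v - u) / 2 + x) / 2) - Real.exp (((u - v) / 2 + y) / 2))]
  calc _ ≤ ∫ ω, (Real.exp ((v - u) / 2) / 2 * Real.exp (∑ i, p i * (ξ ((i : ℕ) : ℤ) ω - σ))
        + Real.exp ((u - v) / 2) / 2 * Real.exp (∑ i, q i * (ξ ((i : ℕ) : ℤ) ω - σ))) ∂P :=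
        integral_mono_of_nonneg (ae_of_all _ fun ω => (Real.exp_pos _).le)
          (((hint p).const_mul _).add ((hint q).const_mul _)) (ae_of_all _ hpt)
    _ ≤ Real.exp ((v - u) / 2) / 2 * Real.exp u + Real.exp ((u - v) / 2) / 2 * Real.exp v := by
        rw [integral_add ((hint p).const_mul _) ((hint q).const_mul _), integral_const_mul,
          integral_const_mul]
        gcongr
    _ = Real.exp ((u + v) / 2) := by
        rw [div_mul_eq_mul_div, div_mul_eq_mul_div, ← Real.exp_add, ← Real.exp_add]
        ring_nf
    _ ≤ _ := by
        rw [Real.exp_le_exp, huv, Finset.sum_range, Finset.mul_sum]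
        refine Finset.sum_le_sum fun i _ => ?_
        simp only [hbdef]
        nlinarith [sq_nonneg (lam * a i)]
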